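/- In the algebra Uı, for all integers t ≥ 0 and l ≥ 0, the following identity holds: B₁^{(l+1)} B₂^{(l+t)} B₁^{(t)} = B₂^{(t)} B₁^{(l+t+1)} B₂^{(l)} + B₂^{(t−1)} B₁^{(l+t+1)} B₂^{(l+1)} − B₂^{(t−1)} B₁^{(l+t)} B₂^{(l)} · {k₁; l − t − 1/2}, where divided powers with negative superscript are zero. -/

import Mathlib

noncomputable section

namespace UiAIII

/-- The base field `K = ℚ(t)`, where `q := t²`. -/
abbrev K : Type := RatFunc ℚ

/-- `t^s` for `s : ℤ`; so `tz (2*n)` represents `q^n` and `tz s` represents `q^{s/2}`. -/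
def tz (s : ℤ) : K := (RatFunc.X : K) ^ s

/-- The quantum integer `[n] = (q^n - q^{-n})/(q - q^{-1})`, with `q = t²`. -/
def qint (n : ℤ) : K := (tz (2 * n) - tz (-(2 * n))) / (tz 2 - tz (-2))

/-- The quantum factorial `[n]!`. -/
def qfact (n : ℕ) : K := ∏ i ∈ Finset.range n, qint ((i : ℤ) + 1)

variable {A : Type*} [Ring A] [Algebra K A]

/-- Divided power `x^{(m)} = x^m/[m]!` for `m ≥ 0`, and `0` for `m < 0`. -/
def dp (x : A) (m : ℤ) : A := if 0 ≤ m then (qfact m.toNat)⁻¹ • x ^ m.toNat else 0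

/-- `{k; s/2} := q^{s/2}·k + q^{-s/2}·k⁻¹`; the argument `s` is twice the half-integer. -/
def brace (k kinv : A) (s : ℤ) : A := tz s • k + tz (-s) • kinv

/-- `k^j` for `j : ℤ`, using the two-sided inverse `kinv` of `k`. -/
def upow (k kinv : A) (j : ℤ) : A := if 0 ≤ j then k ^ j.toNat else kinv ^ (-j).toNat

end UiAIII

open UiAIII

namespace UiAIII

theorem tz_add (a b : ℤ) : tz (a + b) = tz a * tz b :=
  zpow_add₀ RatFunc.X_ne_zero a b

theorem tz_neg (a : ℤ) : tz (-a) = (tz a)⁻¹ :=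
  zpow_neg _ _

theorem tz_ne_zero (a : ℤ) : tz a ≠ 0 :=
  zpow_ne_zero _ RatFunc.X_ne_zero

theorem tz_zero : tz 0 = 1 := zpow_zero _

theorem ratFunc_X_pow_ne_one {n : ℕ} (hn : n ≠ 0) : (RatFunc.X : K) ^ n ≠ 1 := by
  intro h
  have h1 : (algebraMap (Polynomial ℚ) K) (Polynomial.X ^ n) = algebraMap _ _ 1 := by
    simpa [RatFunc.algebraMap_X] using h
  have h2 := congrArg Polynomial.natDegree (RatFunc.algebraMap_injective ℚ h1)
  simp at h2
  exact hn h2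

theorem tz_ne_one {n : ℕ} (hn : n ≠ 0) : tz n ≠ 1 := by
  rw [tz, zpow_natCast]
  exact ratFunc_X_pow_ne_one hn

theorem tz_sub_tz_neg_ne_zero {n : ℕ} (hn : n ≠ 0) : tz n - tz (-n) ≠ 0 := by
  intro h
  have h1 : tz ((n + n : ℕ) : ℤ) = 1 := by
    rw [Nat.cast_add, tz_add]
    nth_rewrite 2 [sub_eq_zero.mp h]
    rw [← tz_add, add_neg_cancel, tz_zero]
  exact tz_ne_one (by omega) h1

theorem tz_two_sub_ne_zero : tz 2 - tz (-2) ≠ 0 :=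
  tz_sub_tz_neg_ne_zero (n := 2) two_ne_zero

theorem qint_succ_ne_zero (n : ℕ) : qint ((n : ℤ) + 1) ≠ 0 := by
  refine div_ne_zero ?_ tz_two_sub_ne_zero
  have := tz_sub_tz_neg_ne_zero (n := 2 * (n + 1)) (by omega)
  push_cast at this
  exact this

theorem qint_one : qint 1 = 1 := div_self tz_two_sub_ne_zero

theorem qint_zero : qint 0 = 0 := by simp [qint]

theorem tz_two_pow_two_sub_one_ne_zero : tz 2 ^ 2 - 1 ≠ 0 := by
  have h := mul_ne_zero (tz_ne_zero 2) tz_two_sub_ne_zero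
  rwa [mul_sub, ← tz_add 2 (-2), add_neg_cancel, tz_zero, ← pow_two] at h

theorem qint_eq (n : ℤ) : qint n = (tz (2 * n) - (tz (2 * n))⁻¹) * tz 2 / (tz 2 ^ 2 - 1) := by
  have h := tz_two_pow_two_sub_one_ne_zero
  have h2 := tz_ne_zero 2
  rw [qint, tz_neg, tz_neg]
  field_simp

theorem qint_add (a b : ℤ) : qint (a + b) = tz (2 * a) * qint b + tz (-(2 * b)) * qint a := by
  have h := tz_two_pow_two_sub_one_ne_zero
  have ha := tz_ne_zero (2 * a)
  have hb := tz_ne_zero (2 * b)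
  simp only [qint_eq, mul_add, tz_add, tz_neg]
  field_simp
  ring

theorem qint_mul_sub (a b : ℤ) :
    qint a * qint (b + 1) - qint b * qint (a + 1) = qint (a - b) := by
  have h := tz_two_pow_two_sub_one_ne_zero
  have ha := tz_ne_zero (2 * a)
  have hb := tz_ne_zero (2 * b)
  have h2 := tz_ne_zero 2
  simp only [qint_eq, mul_add, sub_eq_add_neg a b, mul_neg, tz_add, tz_neg, mul_one]
  field_simp
  ring

theorem qint_add_two (a : ℤ) : qint (a + 2) = qint 2 * qint (a + 1) - qint a := by
  have h := qint_mul_sub (a + 1) 1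
  rw [qint_one, add_sub_cancel_right, one_mul, add_assoc, one_add_one_eq_two] at h
  linear_combination -h

/- The instances found by default go through `ℚ`, where `module` does not unify them. -/
local instance : Algebra ℕ K := Semiring.toNatAlgebra

local instance : Algebra ℤ K := Ring.toIntAlgebra _

variable {A : Type*} [Ring A] [Algebra K A]

/-- The defining relations of the iquantum group, for elements of a `K`-algebra. -/
structure Relations (x y k k' : A) : Prop where
  mul_inv : k * k' = 1
  inv_mul : k' * k = 1
  k_mul_left : k * x = tz (-6) • (x * k)
  k_mul_right : k * y = tz 6 • (y * k)
  serre_left : x ^ 2 * y - qint 2 • (x * y * x) + y * x ^ 2 = qint 2 • (x * brace k k' (-3))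
  serre_right : y ^ 2 * x - qint 2 • (y * x * y) + x * y ^ 2 = qint 2 • (y * brace k k' 3)

theorem inv_mul_of_mul_eq_smul {k k' z : A} {c : ℤ} (h : k * k' = 1) (h' : k' * k = 1)
    (hz : k * z = tz c • (z * k)) : k' * z = tz (-c) • (z * k') := by
  have h1 : z * k' = tz c • (k' * z) := by
    calc z * k' = k' * (k * z) * k' := by rw [← mul_assoc k', h', one_mul]
      _ = tz c • (k' * z) := by
        rw [hz, mul_smul_comm, smul_mul_assoc, mul_assoc, mul_assoc, h, mul_one]
  rw [h1, smul_smul, ← tz_add, neg_add_cancel, tz_zero, one_smul]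

theorem brace_neg (k k' : A) (s : ℤ) : brace k' k (-s) = brace k k' s := by
  rw [brace, brace, neg_neg, add_comm]

theorem Relations.swap {x y k k' : A} (h : Relations x y k k') : Relations y x k' k where
  mul_inv := h.inv_mul
  inv_mul := h.mul_inv
  k_mul_left := inv_mul_of_mul_eq_smul h.mul_inv h.inv_mul h.k_mul_right
  k_mul_right := inv_mul_of_mul_eq_smul h.mul_inv h.inv_mul h.k_mul_left
  serre_left := by rw [brace_neg]; exact h.serre_right
  serre_right := by
    rw [show (3 : ℤ) = -(-3) by norm_num, brace_neg]; exact h.serre_left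

theorem qint_add_smul_brace (a b s : ℤ) (k k' : A) :
    qint (a + b) • brace k k' s
      = qint b • brace k k' (s + 2 * a) + qint a • brace k k' (s - 2 * b) := by
  have h1 := qint_add a b
  have h2 := qint_add b a
  rw [add_comm b a] at h2
  simp only [brace, sub_eq_add_neg, neg_add, neg_neg, tz_add]
  linear_combination (norm := module) congrArg (fun c => (tz s * c) • k) h1
    + congrArg (fun c => (tz (-s) * c) • k') h2

namespace Relations

variable {x y k k' : A}

theorem brace_mul_right (h : Relations x y k k') (s : ℤ) :
    brace k k' s * y = y * brace k k' (s + 6) := by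
  simp only [brace, add_mul, mul_add, smul_mul_assoc, mul_smul_comm, h.k_mul_right,
    h.swap.k_mul_left, smul_smul, ← tz_add]
  rw [neg_add]

theorem brace_mul_left (h : Relations x y k k') (s : ℤ) :
    brace k k' s * x = x * brace k k' (s - 6) := by
  rw [← brace_neg, h.swap.brace_mul_right, ← brace_neg, neg_add, neg_neg, sub_eq_add_neg]

theorem brace_mul_left_pow (h : Relations x y k k') (s : ℤ) (n : ℕ) :
    brace k k' s * x ^ n = x ^ n * brace k k' (s - 6 * n) := by
  induction n with
  | zero => simp
  | succ n ih =>
    rw [pow_succ, ← mul_assoc, ih, mul_assoc, h.brace_mul_left, ← mul_assoc]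
    congr 2; push_cast; ring

theorem brace_mul_right_pow (h : Relations x y k k') (s : ℤ) (n : ℕ) :
    brace k k' s * y ^ n = y ^ n * brace k k' (s + 6 * n) := by
  rw [← brace_neg, h.swap.brace_mul_left_pow, ← brace_neg, neg_sub, sub_neg_eq_add, add_comm]

theorem commute_mul_mul (h : Relations x y k k') : Commute (x * y) (y * x) := by
  have h1 := congrArg (x * ·) h.serre_right
  have h2 := congrArg (· * y) h.serre_left
  simp only [mul_add, mul_sub, add_mul, sub_mul, smul_mul_assoc, mul_smul_comm, pow_two, mul_assoc,
    h.brace_mul_right] at h1 h2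
  norm_num at h1 h2
  simp only [Commute, SemiconjBy, mul_assoc]
  linear_combination (norm := module) h1 - h2

theorem commute_k_mul (h : Relations x y k k') : Commute k (x * y) := by
  rw [Commute, SemiconjBy, ← mul_assoc, h.k_mul_left, smul_mul_assoc, mul_assoc, h.k_mul_right,
    mul_smul_comm, smul_smul, ← tz_add, neg_add_cancel, tz_zero, one_smul, mul_assoc]

theorem mul_pow_succ (h : Relations x y k k') (m : ℕ) :
    x * y ^ (m + 1) = qint (m + 1) • (y ^ m * x * y) - qint m • (y ^ (m + 1) * x)
      + (qint (m + 1) * qint m) • (y ^ m * brace k k' (2 * m + 1)) := by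
  induction m with
  | zero => simp [qint_zero, qint_one]
  | succ m ih =>
    have h1 := congrArg (y ^ m * ·) h.serre_right
    have h2 := qint_add_two m
    have h3 : qint (m + 2) • brace k k' (2 * m + 3)
        = qint m • brace k k' (2 * m + 7) + qint 2 • brace k k' 3 := by
      rw [add_comm, qint_add_smul_brace]
      ring_nf
    rw [h2] at h3
    replace h3 := congrArg (fun z => y ^ m * (y * z)) h3
    rw [pow_succ, ← mul_assoc, ih]
    simp only [mul_add, mul_sub, add_mul, sub_mul, smul_mul_assoc, mul_smul_comm, pow_succ,
      mul_assoc, h.brace_mul_right, pow_zero, one_mul] at h1 h3 ⊢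
    rw [Nat.cast_succ, show (2 : ℤ) * (m + 1) + 1 = 2 * m + 3 by ring,
      show (2 : ℤ) * m + 1 + 6 = 2 * m + 7 by ring, show (m : ℤ) + 1 + 1 = m + 2 by ring, h2]
    linear_combination (norm := module) qint (m + 1) • h1 - qint (m + 1) • h3

theorem pow_succ_mul (h : Relations x y k k') (m : ℕ) :
    x ^ (m + 1) * y = qint (m + 1) • (x * y * x ^ m) - qint m • (y * x ^ (m + 1))
      + (qint (m + 1) * qint m) • (x ^ m * brace k k' (1 - 4 * m)) := by
  induction m with
  | zero => simp [qint_zero, qint_one]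
  | succ m ih =>
    have h1 := congrArg (· * x ^ m) h.serre_left
    have h2 := qint_add_two m
    have h3 : qint (m + 2) • brace k k' (-3 - 4 * m)
        = qint m • brace k k' (1 - 4 * m) + qint 2 • brace k k' (-3 - 6 * m) := by
      rw [add_comm, qint_add_smul_brace]
      ring_nf
    rw [h2] at h3
    replace h3 := congrArg (fun z => x * (x ^ m * z)) h3
    rw [pow_succ', mul_assoc, ih]
    simp only [mul_add, mul_sub, add_mul, sub_mul, smul_mul_assoc, mul_smul_comm, pow_succ',
      mul_assoc, h.brace_mul_left_pow, pow_zero, mul_one] at h1 h3 ⊢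
    rw [Nat.cast_succ, show (1 : ℤ) - 4 * (m + 1) = -3 - 4 * m by ring,
      show (m : ℤ) + 1 + 1 = m + 2 by ring, h2]
    linear_combination (norm := module) qint (m + 1) • h1 - qint (m + 1) • h3

theorem mul_pow_mul_pow (h : Relations x y k k') (s n : ℕ) :
    qint (n + 1) • (x * y ^ (s + 1) * x ^ n) = qint (n - s) • (y ^ (s + 1) * x ^ (n + 1))
      + qint (s + 1) • (y ^ s * x ^ (n + 1) * y)
      - (qint (s + 1) * qint (n + 1) * qint (n - s)) •
          (y ^ s * x ^ n * brace k k' (2 * s + 1 - 4 * n)) := by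
  have h1 := congrArg (· * x ^ n) (h.mul_pow_succ s)
  have h2 := congrArg (y ^ s * ·) (h.pow_succ_mul n)
  have h3 : qint n • brace k k' (1 - 4 * n)
      = qint (n - s) • brace k k' (2 * s + 1 - 4 * n) + qint s • brace k k' (2 * s + 1 - 6 * n) := by
    convert qint_add_smul_brace s (n - s) (1 - 4 * n) k k' using 4 <;> ring
  replace h3 := congrArg (fun z => y ^ s * (x ^ n * z)) h3
  have h4 := congrArg (· • (y ^ s * (y * (x ^ n * x)))) (qint_mul_sub n s)
  simp only [mul_add, mul_sub, add_mul, sub_mul, smul_mul_assoc, mul_smul_comm, pow_succ,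
      mul_assoc, h.brace_mul_left_pow] at h1 h2 h3 h4 ⊢
  rw [← pow_mul_comm'] at h1
  linear_combination (norm := module) qint (n + 1) • h1 - qint (s + 1) • h2 + h4
    - (qint (n + 1) * qint (s + 1)) • h3

theorem commute_pow_mul_pow (h : Relations x y k k') {z : A} (h1 : Commute z (x * y))
    (h2 : Commute z (y * x)) (h3 : Commute z k) (h4 : Commute z k') (m : ℕ) :
    Commute z (x ^ m * y ^ m) := by
  induction m with
  | zero => simp
  | succ m ih =>
    have h5 : x ^ (m + 1) * y ^ (m + 1)
        = qint (m + 1) • (x ^ m * y ^ m * (x * y)) - qint m • (x ^ m * y ^ m * (y * x))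
          + (qint (m + 1) * qint m) • (x ^ m * y ^ m * brace k k' (2 * m + 1)) := by
      rw [pow_succ, mul_assoc, h.mul_pow_succ, pow_succ]
      simp only [mul_add, mul_sub, mul_smul_comm, mul_assoc]
    rw [h5]
    exact ((((ih.mul_right h1).smul_right _).sub_right ((ih.mul_right h2).smul_right _)).add_right
      ((ih.mul_right ((h3.smul_right _).add_right (h4.smul_right _))).smul_right _))

theorem commute_inv_mul (h : Relations x y k k') : Commute k' (x * y) := by
  rw [Commute, SemiconjBy, ← mul_assoc, h.swap.k_mul_right, smul_mul_assoc, mul_assoc,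
    h.swap.k_mul_left, mul_smul_comm, smul_smul, ← tz_add, add_neg_cancel, tz_zero, one_smul,
    mul_assoc]

theorem commute_inv (h : Relations x y k k') : Commute k k' := by
  rw [Commute, SemiconjBy, h.mul_inv, h.inv_mul]

theorem pow_mul_pow_mul_pow (h : Relations x y k k') (l t : ℕ) :
    x ^ l * y ^ (l + t) * x ^ t = y ^ t * x ^ (l + t) * y ^ l := by
  have hs := h.swap
  have h1 : Commute (y ^ t * x ^ t) (x ^ l * y ^ l) := by
    refine h.commute_pow_mul_pow ?_ ?_ ?_ ?_ l <;> refine (hs.commute_pow_mul_pow ?_ ?_ ?_ ?_ t).symm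
    exacts [h.commute_mul_mul, Commute.refl _, h.commute_inv_mul.symm, h.commute_k_mul.symm,
      Commute.refl _, hs.commute_mul_mul, hs.commute_k_mul.symm, hs.commute_inv_mul.symm,
      hs.commute_inv_mul, h.commute_k_mul, h.commute_inv, Commute.refl _,
      hs.commute_k_mul, h.commute_inv_mul, Commute.refl _, hs.commute_inv]
  calc x ^ l * y ^ (l + t) * x ^ t = x ^ l * y ^ l * (y ^ t * x ^ t) := by
        simp only [pow_add, mul_assoc]
    _ = y ^ t * x ^ t * (x ^ l * y ^ l) := h1.eq.symm
    _ = y ^ t * x ^ (l + t) * y ^ l := by rw [add_comm l t]; simp only [pow_add, mul_assoc]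

theorem pow_mul_pow_mul_pow_of_succ (h : Relations x y k k') (l s : ℕ) :
    qint (l + s + 2) • (x ^ (l + 1) * y ^ (l + s + 1) * x ^ (s + 1))
      = qint (l + 1) • (y ^ (s + 1) * x ^ (l + s + 2) * y ^ l)
        + qint (s + 1) • (y ^ s * x ^ (l + s + 2) * y ^ (l + 1))
        - (qint (s + 1) * qint (l + s + 2) * qint (l + 1)) •
          (y ^ s * x ^ (l + s + 1) * y ^ l * brace k k' (2 * l - 2 * s - 3)) := by
  have h1 : x ^ (l + 1) * y ^ (l + s + 1) * x ^ (s + 1)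
      = x * y ^ (s + 1) * x ^ (l + s + 1) * y ^ l := by
    have := congrArg (x * ·) (h.pow_mul_pow_mul_pow l (s + 1))
    simpa only [← mul_assoc, ← pow_succ', ← add_assoc] using this
  have h2 := congrArg (· * y ^ l) (h.mul_pow_mul_pow s (l + s + 1))
  simp only [add_mul, sub_mul, smul_mul_assoc] at h2
  rw [mul_assoc _ (brace _ _ _), h.brace_mul_right_pow, ← mul_assoc, mul_assoc _ y,
    ← pow_succ'] at h2
  push_cast at h2
  rw [show (l : ℤ) + s + 1 - s = l + 1 by ring, show (l : ℤ) + s + 1 + 1 = l + s + 2 by ring,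
    show (2 : ℤ) * s + 1 - 4 * (l + s + 1) + 6 * l = 2 * l - 2 * s - 3 by ring, ← h1] at h2
  exact h2

end Relations

theorem qfact_succ (n : ℕ) : qfact (n + 1) = qfact n * qint (n + 1) :=
  Finset.prod_range_succ _ _

theorem qfact_ne_zero (n : ℕ) : qfact n ≠ 0 :=
  Finset.prod_ne_zero_iff.mpr fun i _ => qint_succ_ne_zero i

theorem dp_natCast (x : A) (n : ℕ) : dp x (n : ℤ) = (qfact n)⁻¹ • x ^ n := by
  rw [dp, if_pos (Int.natCast_nonneg n), Int.toNat_natCast]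

theorem Relations.dp_mul_dp_mul_dp {x y k k' : A} (h : Relations x y k k') (l s : ℕ) :
    dp x (l + 1 : ℕ) * dp y (l + s + 1 : ℕ) * dp x (s + 1 : ℕ)
      = dp y (s + 1 : ℕ) * dp x (l + s + 2 : ℕ) * dp y l
        + dp y s * dp x (l + s + 2 : ℕ) * dp y (l + 1 : ℕ)
        - dp y s * dp x (l + s + 1 : ℕ) * dp y l * brace k k' (2 * l - 2 * s - 3) := by
  have h1 := h.pow_mul_pow_mul_pow_of_succ l s
  have hl := qint_succ_ne_zero l
  have hs := qint_succ_ne_zero s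
  have hls : qint ((l : ℤ) + s + 2) ≠ 0 := by
    convert qint_succ_ne_zero (l + s + 1) using 2
    push_cast; ring
  have hls' : qfact (l + s + 2) = qfact (l + s + 1) * qint (l + s + 2) := by
    rw [qfact_succ]
    push_cast
    ring_nf
  have fl := qfact_ne_zero l
  have fs := qfact_ne_zero s
  have fls := qfact_ne_zero (l + s + 1)
  simp only [dp_natCast, hls', qfact_succ l, qfact_succ s, smul_mul_assoc, mul_smul_comm, smul_smul]
  have h2 := congrArg ((qfact l * qint (l + 1) * qfact (l + s + 1) * qfact s * qint (s + 1) *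
    qint (l + s + 2))⁻¹ • ·) h1
  simp only [smul_add, smul_sub, smul_smul] at h2
  linear_combination (norm := (match_scalars <;> field_simp <;> ring)) h2

end UiAIII

/-- Identity (4.9) of the paper: for all `t, l ≥ 0`,
`B₁^{(l+1)}B₂^{(l+t)}B₁^{(t)} = B₂^{(t)}B₁^{(l+t+1)}B₂^{(l)} + B₂^{(t−1)}B₁^{(l+t+1)}B₂^{(l+1)}
   − B₂^{(t−1)}B₁^{(l+t)}B₂^{(l)}·{k₁; l−t−1/2}`,
in any algebra with elements satisfying the defining relations of the quasi-split iquantum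
group Uı of type AIII for sl₃ with parameters ς₁ = ς₂ = −q^{1/2}. -/
theorem statement3 (A : Type*) [Ring A] [Algebra K A]
    (B1 B2 k1 k1' : A)
    (hk : k1 * k1' = 1) (hk' : k1' * k1 = 1)
    (hkB1 : k1 * B1 = tz (-6) • (B1 * k1))
    (hkB2 : k1 * B2 = tz 6 • (B2 * k1))
    (hS1 : B1 ^ 2 * B2 - qint 2 • (B1 * B2 * B1) + B2 * B1 ^ 2
        = qint 2 • (B1 * (tz (-3) • k1 + tz 3 • k1')))
    (hS2 : B2 ^ 2 * B1 - qint 2 • (B2 * B1 * B2) + B1 * B2 ^ 2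
        = qint 2 • (B2 * (tz 3 • k1 + tz (-3) • k1')))
    (t l : ℕ) :
    dp B1 ((l : ℤ) + 1) * dp B2 ((l : ℤ) + t) * dp B1 (t : ℤ)
      = dp B2 (t : ℤ) * dp B1 ((l : ℤ) + t + 1) * dp B2 (l : ℤ)
        + dp B2 ((t : ℤ) - 1) * dp B1 ((l : ℤ) + t + 1) * dp B2 ((l : ℤ) + 1)
        - dp B2 ((t : ℤ) - 1) * dp B1 ((l : ℤ) + t) * dp B2 (l : ℤ) *
            brace k1 k1' (2 * (l : ℤ) - 2 * (t : ℤ) - 1) := by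
  have h : Relations B1 B2 k1 k1' := ⟨hk, hk', hkB1, hkB2, hS1, hS2⟩
  cases t with
  | zero => simp [dp, qfact]
  | succ s =>
    have h1 := h.dp_mul_dp_mul_dp l s
    push_cast at h1 ⊢
    convert h1 using 3 <;> ring_nf
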